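/- Let p ≥ 5 be a prime and let D be a nontrivial regular (8p^3, 4p^2+2p+1, 2p+4, 2p+2)-partial difference set in an Abelian group G of order 8p^3. Then for every subgroup H of G of order 8p^2, either |D ∩ H| = 2p+5 or |D ∩ H| = 6p+1. -/

import Mathlib

variable {G : Type*} [CommGroup G] [DecidableEq G] [Fintype G]

/-- The number of representations of `g` as `d₁ * d₂⁻¹` with `d₁, d₂ ∈ D`, `d₁ ≠ d₂`. -/
def pdsReps (D : Finset G) (g : G) : ℕ :=
  ((D ×ˢ D).filter (fun x => x.1 ≠ x.2 ∧ x.1 * x.2⁻¹ = g)).card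

/-- `D` is a `(v,k,λ,μ)`-partial difference set in `G`. -/
def IsPDS (D : Finset G) (v k l m : ℕ) : Prop :=
  Fintype.card G = v ∧ D.card = k ∧
  (∀ g : G, g ≠ 1 → g ∈ D → pdsReps D g = l) ∧
  (∀ g : G, g ≠ 1 → g ∉ D → pdsReps D g = m)

/-- `D` is regular: closed under inverses and not containing the identity. -/
def IsRegularPDS (D : Finset G) : Prop :=
  (∀ d ∈ D, d⁻¹ ∈ D) ∧ (1 : G) ∉ D

/-- A regular PDS is trivial if `D ∪ {e}` or `G \ D` is a subgroup. -/
def IsTrivialPDS (D : Finset G) : Prop :=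
  (∃ H : Subgroup G, (H : Set G) = ↑D ∪ {1}) ∨
  (∃ H : Subgroup G, (H : Set G) = (↑D : Set G)ᶜ)

section CharacterSums

open Finset

variable {A : Type*} [CommGroup A]

/-- A subgroup of prime index `p` is the kernel of a complex character with values in the
`p`-th roots of unity. -/
theorem exists_character_of_prime_index {p : ℕ} (hp : p.Prime) (H : Subgroup A)
    (hH : H.index = p) :
    ∃ χ : A →* ℂ, (∀ g, χ g = 1 ↔ g ∈ H) ∧ ∀ g, χ g ^ p = 1 := by
  have : Fact p.Prime := ⟨hp⟩
  have : NeZero p := ⟨hp.ne_zero⟩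
  have hcard : Nat.card (rootsOfUnity p ℂ) = p :=
    Complex.card_rootsOfUnity p
  let e : A ⧸ H ≃* rootsOfUnity p ℂ := mulEquivOfPrimeCardEq (p := p) hH hcard
  let ψ : A →* rootsOfUnity p ℂ := e.toMonoidHom.comp (QuotientGroup.mk' H)
  refine ⟨(Units.coeHom ℂ).comp ((rootsOfUnity p ℂ).subtype.comp ψ), fun g => ?_, fun g => ?_⟩
  · have : ψ g = 1 ↔ g ∈ H := by simp [ψ]
    simpa using this
  · exact (mem_rootsOfUnity' p _).mp (ψ g).2

/-- The square of a nontrivial character sum over a regular partial difference set. -/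
theorem IsPDS.sum_character_sq [DecidableEq A] [Fintype A] {D : Finset A} {v k l m : ℕ}
    (hD : IsPDS D v k l m) (hreg : IsRegularPDS D) (χ : A →* ℂ) (hχ : χ ≠ 1) :
    (∑ d ∈ D, χ d) ^ 2 = k - m + ((l : ℂ) - m) * ∑ d ∈ D, χ d := by
  obtain ⟨-, hk, hl, hm⟩ := hD
  have hinv : ∑ d ∈ D, χ d⁻¹ = ∑ d ∈ D, χ d :=
    sum_bij' (fun d _ => d⁻¹) (fun d _ => d⁻¹) hreg.1 hreg.1 (by simp) (by simp) (by simp)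
  have hdiag : ∑ x ∈ (D ×ˢ D).filter (fun x => ¬ x.1 ≠ x.2), χ (x.1 * x.2⁻¹) = k := by
    have hone : ∀ x ∈ (D ×ˢ D).filter (fun x => ¬ x.1 ≠ x.2), χ (x.1 * x.2⁻¹) = 1 := by
      intro x hx
      have hx2 : x.1 = x.2 := by simpa using (mem_filter.mp hx).2
      simp [hx2]
    rw [sum_congr rfl hone]
    have hfilter : (D ×ˢ D).filter (fun x => ¬ x.1 ≠ x.2) = D.diag := by
      ext x
      simp only [mem_filter, mem_product, mem_diag]
      grind
    rw [hfilter, sum_const, diag_card, hk, nsmul_eq_mul, mul_one]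
  have hoff : ∑ x ∈ (D ×ˢ D).filter (fun x => x.1 ≠ x.2), χ (x.1 * x.2⁻¹) =
      ∑ g, (pdsReps D g : ℂ) * χ g := by
    rw [← sum_fiberwise _ (fun x : A × A => x.1 * x.2⁻¹)]
    refine sum_congr rfl fun g _ => ?_
    rw [pdsReps, filter_filter, ← nsmul_eq_mul, ← sum_const]
    exact sum_congr rfl fun x hx => by rw [(mem_filter.mp hx).2.2]
  have hreps (g : A) : (pdsReps D g : ℂ) =
      m + (if g ∈ D then (l : ℂ) - m else 0) - (if g = 1 then (m : ℂ) else 0) := by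
    by_cases h1 : g = 1
    · subst h1
      have hzero : pdsReps D 1 = 0 := by
        rw [pdsReps, card_eq_zero, filter_eq_empty_iff]
        rintro x - ⟨hne, heq⟩
        exact hne (mul_inv_eq_one.mp heq)
      simp [hzero, hreg.2]
    · by_cases hg : g ∈ D
      · simp [h1, hg, hl g h1 hg]
      · simp [h1, hg, hm g h1 hg]
  have hsum : ∑ g, χ g = 0 := sum_hom_units_eq_zero χ hχ
  have hexp : ∑ g, (pdsReps D g : ℂ) * χ g = ((l : ℂ) - m) * ∑ d ∈ D, χ d - m := by
    simp only [hreps, sub_mul, add_mul, sum_sub_distrib, sum_add_distrib, ← mul_sum, hsum,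
      ite_mul, zero_mul, sum_ite_mem, sum_ite_eq', univ_inter, mem_univ, if_true, map_one]
    ring
  calc (∑ d ∈ D, χ d) ^ 2 = (∑ d ∈ D, χ d) * ∑ d ∈ D, χ d⁻¹ := by rw [hinv, sq]
    _ = ∑ x ∈ D ×ˢ D, χ (x.1 * x.2⁻¹) := by
      rw [sum_mul_sum, sum_product]
      simp
    _ = _ := by
      rw [← sum_filter_add_sum_filter_not _ (fun x : A × A => x.1 ≠ x.2), hdiag, hoff, hexp]
      ring

/-- If a character with values in the `p`-th roots of unity, `p` prime, has an integral sum `c`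
over `D`, then `c` determines the number of elements of `D` in the kernel of the character. -/
theorem card_kernel_of_sum_character_eq_int {p : ℕ} (hp : p.Prime) (D : Finset A) (χ : A →* ℂ)
    (hχ : ∀ g, χ g ^ p = 1) (c : ℤ) (hc : ∑ d ∈ D, χ d = c) :
    (p : ℤ) * #{d ∈ D | χ d = 1} = #D + (p - 1) * c := by
  have : NeZero p := ⟨hp.ne_zero⟩
  obtain ⟨ζ, hζ⟩ : ∃ ζ : ℂ, IsPrimitiveRoot ζ p := ⟨_, Complex.isPrimitiveRoot_exp p hp.ne_zero⟩
  choose a ha using fun g => (show ∃ i : Fin p, ζ ^ (i : ℕ) = χ g by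
    obtain ⟨i, hi, h⟩ := hζ.eq_pow_of_pow_eq_one (hχ g)
    exact ⟨⟨i, hi⟩, h⟩)
  have hzero (g : A) : a g = 0 ↔ χ g = 1 := by
    rw [← ha, hζ.pow_eq_one_iff_dvd]
    constructor
    · intro h; simp [h]
    · intro h
      exact Fin.ext (Nat.eq_zero_of_dvd_of_lt h (a g).2)
  let f : Fin p → ℤ := fun i => #{d ∈ D | a d = i}
  have hf0 : f 0 = #{d ∈ D | χ d = 1} := by simp [f, hzero]
  have hfsum : ∑ i, f i = #D := by
    rw [card_eq_sum_card_fiberwise (f := a) (t := univ) (by simp)]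
    simp [f]
  have hfζ : ∑ i, (f i : ℂ) * ζ ^ (i : ℕ) = c := by
    rw [← hc, ← sum_fiberwise D a]
    refine sum_congr rfl fun i _ => ?_
    rw [sum_congr rfl (g := fun _ => ζ ^ (i : ℕ))
      fun d hd => by rw [← ha, (mem_filter.mp hd).2]]
    simp [f]
  have heq := (hζ.sum_eq_zero_iff_forall_eq_int hp (fun i => f i - if i = 0 then c else 0)).mp
    (by simp [sub_mul, sum_sub_distrib, hfζ])
  have hfi (i : Fin p) : f i = f 0 - c + if i = 0 then c else 0 := by
    have := heq i 0
    simp only [if_true] at this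
    linarith
  have hall : ∑ i, f i = p * (f 0 - c) + c := by
    rw [sum_congr rfl fun i _ => hfi i]
    simp [sum_add_distrib, mul_sub]
  rw [← hf0]
  linarith

end CharacterSums

/-- For a nontrivial regular `(8p^3, 4p^2+2p+1, 2p+4, 2p+2)`-PDS `D` in an
Abelian group `G`, every subgroup `H` of order `8p^2` meets `D` in either
`2p+5` or `6p+1` elements. -/
theorem pds_case2_subgroup_intersection (p : ℕ) (hp : p.Prime) (hp5 : 5 ≤ p)
    {G : Type*} [CommGroup G] [DecidableEq G] [Fintype G]
    (D : Finset G)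
    (hPDS : IsPDS D (8 * p ^ 3) (4 * p ^ 2 + 2 * p + 1) (2 * p + 4) (2 * p + 2))
    (hreg : IsRegularPDS D) (hnt : ¬ IsTrivialPDS D)
    (H : Subgroup G) (hH : Nat.card H = 8 * p ^ 2) :
    ((D : Set G) ∩ (H : Set G)).ncard = 2 * p + 5 ∨
      ((D : Set G) ∩ (H : Set G)).ncard = 6 * p + 1 := by
  have hindex : H.index = p := by
    have h := H.card_mul_index
    rw [hH, Nat.card_eq_fintype_card, hPDS.1] at h
    refine Nat.eq_of_mul_eq_mul_left (show 0 < 8 * p ^ 2 by positivity) ?_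
    rw [h]
    ring
  obtain ⟨χ, hker, hpow⟩ := exists_character_of_prime_index hp H hindex
  have hχ : χ ≠ 1 := by
    rintro rfl
    have htop : H = ⊤ := eq_top_iff.mpr fun g _ => (hker g).mp rfl
    rw [htop, Subgroup.index_top] at hindex
    omega
  have hcard : ((D : Set G) ∩ (H : Set G)).ncard = (D.filter fun d => χ d = 1).card := by
    rw [← Set.ncard_coe_finset]
    congr 1
    ext g
    simp [hker]
  have hp0 : (p : ℤ) ≠ 0 := mod_cast hp.ne_zero
  have hsq := hPDS.sum_character_sq hreg χ hχ
  push_cast at hsq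
  have hfactor : (∑ d ∈ D, χ d - (1 + 2 * p)) * (∑ d ∈ D, χ d - (1 - 2 * p)) = 0 := by
    linear_combination hsq
  rw [hcard]
  rcases mul_eq_zero.mp hfactor with h | h
  · right
    have hc := card_kernel_of_sum_character_eq_int hp D χ hpow (1 + 2 * p)
      (by push_cast; linear_combination h)
    rw [hPDS.2.1] at hc
    push_cast at hc
    zify
    exact mul_left_cancel₀ hp0 (by linear_combination hc)
  · left
    have hc := card_kernel_of_sum_character_eq_int hp D χ hpow (1 - 2 * p)
      (by push_cast; linear_combination h)
    rw [hPDS.2.1] at hc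
    push_cast at hc
    zify
    exact mul_left_cancel₀ hp0 (by linear_combination hc)
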